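/- arXiv:1808.05118 — 9 statements merged into one kernel-verified Lean document; each statement's English description precedes it below -/
import Mathlib

section
/- For all positive real numbers a and c, the function g(t) = a·t·(2^{c/t} − 1) is strictly decreasing on (0, ∞). -/
/-- for `a, c > 0`, `g(t) = a·t·(2^{c/t} − 1)` is strictly
decreasing on `(0, ∞)`. -/
theorem stmt_2 (a c : ℝ) (ha : 0 < a) (hc : 0 < c) :
    StrictAntiOn (fun t : ℝ => a * t * ((2 : ℝ) ^ (c / t) - 1)) (Set.Ioi 0) := by
  intro s hs t ht hst
  have hs : 0 < s := hs
  have ht : 0 < t := ht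
  have h1 : (1 : ℝ) < 2 ^ (c / t) := Real.one_lt_rpow (by norm_num) (by positivity)
  have hp : 1 < t / s := (one_lt_div hs).2 hst
  have h2 := one_add_mul_self_lt_rpow_one_add (s := (2 : ℝ) ^ (c / t) - 1) (by linarith)
    (by linarith) hp
  have h3 : (1 + ((2 : ℝ) ^ (c / t) - 1)) ^ (t / s) = 2 ^ (c / s) := by
    rw [add_sub_cancel, ← Real.rpow_mul (by norm_num)]
    congr 1
    field_simp
  rw [h3] at h2
  have h4 : t / s * ((2 : ℝ) ^ (c / t) - 1) < 2 ^ (c / s) - 1 := by linarith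
  have h5 := mul_lt_mul_of_pos_left h4 (mul_pos ha hs)
  have h6 : a * s * (t / s * ((2 : ℝ) ^ (c / t) - 1)) = a * t * ((2 : ℝ) ^ (c / t) - 1) := by
    rw [← mul_assoc]
    congr 1
    field_simp
  rw [h6] at h5
  exact h5
end

section
/- Let c > 0 and define g(t) = t·(2^{c/t} − 1) for t > 0. Then (i) g is differentiable on (0,∞) with g'(t) = (1 − (c·ln 2)/t)·2^{c/t} − 1; (ii) g' is strictly increasing on (0,∞); (iii) g'(t) < 0 for every t > 0, g'(t) → −∞ as t → 0⁺ and g'(t) → 0 as t → ∞; consequently, (iv) for every λ > 0 there exists a unique t > 0 with g'(t) = −λ. -/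
open Filter Topology

theorem phi_anti {u v : ℝ} (hu : 0 ≤ u) (h : u < v) :
    (1 - v) * Real.exp v < (1 - u) * Real.exp u := by
  have hv : Real.exp v = Real.exp u * Real.exp (v - u) := by
    rw [← Real.exp_add]; congr 1; ring
  have h1 : (1 - v) * Real.exp (v - u) < 1 - u := by
    have hd := Real.add_one_le_exp (v - u)
    rcases le_or_gt 1 v with h2 | h2
    · nlinarith
    · have h3 : -(v - u) + 1 < Real.exp (-(v - u)) :=
        Real.add_one_lt_exp (by linarith)
      have h4 : Real.exp (-(v - u)) * Real.exp (v - u) = 1 := by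
        rw [← Real.exp_add]; simp
      have h5 : (1 - v) < (1 - u) * Real.exp (-(v - u)) := by
        nlinarith [mul_lt_mul_of_pos_left h3 (show 0 < 1 - u by linarith),
          mul_nonneg hu (show 0 ≤ v - u by linarith)]
      have h6 := mul_lt_mul_of_pos_right h5 (Real.exp_pos (v - u))
      rwa [mul_assoc, h4, mul_one] at h6
  rw [hv]
  nlinarith [mul_lt_mul_of_pos_left h1 (Real.exp_pos u)]

theorem phi_le {u : ℝ} (hu : 1 ≤ u) : (1 - u) * Real.exp u - 1 ≤ -u := by
  have := Real.one_le_exp (show 0 ≤ u by linarith)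
  nlinarith

/-- properties of `g(t) = t·(2^{c/t} − 1)` and of its derivative
`g'(t) = (1 − (c·ln 2)/t)·2^{c/t} − 1` on `(0, ∞)`. -/
theorem stmt_4 (c : ℝ) (hc : 0 < c) :
    -- (i) differentiability with the stated derivative
    (∀ t : ℝ, 0 < t →
      HasDerivAt (fun s : ℝ => s * ((2 : ℝ) ^ (c / s) - 1))
        ((1 - c * Real.log 2 / t) * (2 : ℝ) ^ (c / t) - 1) t)
    ∧
    -- (ii) g' is strictly increasing on (0, ∞)
    StrictMonoOn (fun t : ℝ => (1 - c * Real.log 2 / t) * (2 : ℝ) ^ (c / t) - 1)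
      (Set.Ioi 0)
    ∧
    -- (iii) g' < 0 on (0, ∞), g'(t) → −∞ as t → 0⁺, g'(t) → 0 as t → ∞
    (∀ t : ℝ, 0 < t → (1 - c * Real.log 2 / t) * (2 : ℝ) ^ (c / t) - 1 < 0)
    ∧
    Tendsto (fun t : ℝ => (1 - c * Real.log 2 / t) * (2 : ℝ) ^ (c / t) - 1)
      (𝓝[>] 0) atBot
    ∧
    Tendsto (fun t : ℝ => (1 - c * Real.log 2 / t) * (2 : ℝ) ^ (c / t) - 1)
      atTop (𝓝 0)
    ∧
    -- (iv) for every λ > 0 there is a unique t > 0 with g'(t) = −λ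
    (∀ l : ℝ, 0 < l →
      ∃! t : ℝ, 0 < t ∧
        (1 - c * Real.log 2 / t) * (2 : ℝ) ^ (c / t) - 1 = -l) := by
  have hk : 0 < c * Real.log 2 := mul_pos hc (Real.log_pos (by norm_num))
  have he : ∀ t : ℝ, (2 : ℝ) ^ (c / t) = Real.exp (c * Real.log 2 / t) := by
    intro t
    rw [Real.rpow_def_of_pos (by norm_num)]; congr 1; ring
  simp only [he]
  generalize c * Real.log 2 = k at hk
  have hmono : StrictMonoOn (fun t : ℝ => (1 - k / t) * Real.exp (k / t) - 1)
      (Set.Ioi 0) := by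
    intro s hs t ht hst
    have hs' : 0 < s := hs
    have ht' : 0 < t := ht
    have := phi_anti (div_pos hk ht').le (div_lt_div_of_pos_left hk hs' hst)
    simp only
    linarith
  refine ⟨?_, hmono, ?_, ?_, ?_, ?_⟩
  · intro t ht
    have h1 : HasDerivAt (fun s : ℝ => k / s) (-k / t ^ 2) t := by
      have := (hasDerivAt_inv ht.ne').const_mul k
      have h0 : k * -(t ^ 2)⁻¹ = -k / t ^ 2 := by ring
      rw [h0] at this
      exact this
    have h2 : HasDerivAt (fun s : ℝ => s * (Real.exp (k / s) - 1))
        (1 * (Real.exp (k / t) - 1) + t * (Real.exp (k / t) * (-k / t ^ 2))) t :=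
      (hasDerivAt_id t).mul ((h1.exp).sub_const 1)
    refine h2.congr_deriv ?_
    field_simp
    ring
  · intro t ht
    have := phi_anti le_rfl (div_pos hk ht)
    simp at this
    linarith
  · have hu : Tendsto (fun t : ℝ => k / t) (𝓝[>] 0) atTop := by
      simp only [div_eq_mul_inv]
      exact tendsto_inv_nhdsGT_zero.const_mul_atTop hk
    refine tendsto_atBot_mono' _ ?_ (tendsto_neg_atTop_atBot.comp hu)
    filter_upwards [hu.eventually_ge_atTop 1] with t ht
    exact phi_le ht
  · have hu : Tendsto (fun t : ℝ => k / t) atTop (𝓝 0) := tendsto_const_nhds.div_atTop tendsto_id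
    have hc : Continuous (fun u : ℝ => (1 - u) * Real.exp u - 1) := by fun_prop
    have := (hc.tendsto 0).comp hu
    simpa [Function.comp_def] using this
  · intro l hl
    have hc : Continuous (fun u : ℝ => (1 - u) * Real.exp u - 1) := by fun_prop
    have hm : (0 : ℝ) ≤ max 1 l := le_trans zero_le_one (le_max_left _ _)
    obtain ⟨u, hu, hul⟩ := intermediate_value_Icc' hm hc.continuousOn
      (show -l ∈ Set.Icc _ _ from
        ⟨(phi_le (le_max_left 1 l)).trans (neg_le_neg (le_max_right 1 l)), by simp [hl.le]⟩)
    simp only at hul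
    have hu0 : 0 < u := by
      rcases hu.1.lt_or_eq with h | h
      · exact h
      · subst h
        simp at hul
        linarith
    refine ⟨k / u, ⟨div_pos hk hu0, ?_⟩, ?_⟩
    · rw [div_div_cancel₀ hk.ne']
      exact hul
    · rintro t ⟨ht, htl⟩
      refine hmono.injOn ht (div_pos hk hu0) ?_
      rw [htl]
      rw [div_div_cancel₀ hk.ne', hul]
end

section
/- Let c, h, n0, λ be positive reals. The unique t > 0 satisfying (1 − (c·ln 2)/t)·2^{c/t} − 1 = −λ·h/n0 is t = (c·ln 2)/(w + 1), where w is the unique real number with w > −1 and w·e^w = λ·h/(n0·e) − 1/e. -/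
theorem aux_lt (a b : ℝ) (ha : -1 < a) (hab : a < b) :
    a * Real.exp a < b * Real.exp b := by
  have hea := Real.exp_pos a
  have heb := Real.exp_pos b
  have h1 : Real.exp a = Real.exp b * Real.exp (a - b) := by
    rw [← Real.exp_add]; congr 1; ring
  have h2 : a - b + 1 ≤ Real.exp (a - b) := Real.add_one_le_exp _
  have h3 : Real.exp (a - b) < 1 := by
    rw [Real.exp_lt_one_iff]; linarith
  have h4 := Real.exp_pos (a - b)
  have key : a * Real.exp (a - b) < b := by
    rcases le_or_gt 0 a with h | h
    · nlinarith
    · nlinarith [mul_pos (sub_pos.2 hab) (by linarith : 0 < 1 + a)]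
  rw [h1]
  nlinarith

theorem aux_inj (a b : ℝ) (ha : -1 < a) (hb : -1 < b)
    (hab : a * Real.exp a = b * Real.exp b) : a = b := by
  rcases lt_trichotomy a b with h | h | h
  · exact absurd hab (aux_lt a b ha h).ne
  · exact h
  · exact absurd hab (aux_lt b a hb h).ne'

/-- the unique `t > 0` with
`(1 − (c·ln 2)/t)·2^{c/t} − 1 = −λ·h/n0` is `t = (c·ln 2)/(w + 1)`, where `w`
is the unique real with `w > −1` and `w·e^w = λ·h/(n0·e) − 1/e`. -/
theorem stmt_5 (c h n0 l : ℝ) (hc : 0 < c) (hh : 0 < h) (hn0 : 0 < n0)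
    (hl : 0 < l) (w : ℝ) (hw : -1 < w)
    (hwe : w * Real.exp w = l * h / (n0 * Real.exp 1) - 1 / Real.exp 1) :
    ∀ t : ℝ,
      (0 < t ∧ (1 - c * Real.log 2 / t) * (2 : ℝ) ^ (c / t) - 1 = -(l * h / n0))
      ↔ t = c * Real.log 2 / (w + 1) := by
  intro t
  have hlog : 0 < Real.log 2 := Real.log_pos (by norm_num)
  have hcl : 0 < c * Real.log 2 := mul_pos hc hlog
  have he := Real.exp_pos 1
  have hw1 : 0 < w + 1 := by linarith
  have hpow : (2 : ℝ) ^ (c / t) = Real.exp (c * Real.log 2 / t) := by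
    rw [Real.rpow_def_of_pos (by norm_num)]; congr 1; ring
  have hwe' : w * (Real.exp w * Real.exp 1) = l * h / n0 - 1 := by
    rw [← mul_assoc, hwe]; field_simp
  rw [hpow]
  constructor
  · rintro ⟨ht, heq⟩
    have hx : 0 < c * Real.log 2 / t := div_pos hcl ht
    have hxw : c * Real.log 2 / t - 1 = w := by
      apply aux_inj _ _ (by linarith) hw
      have h5 : Real.exp (c * Real.log 2 / t)
          = Real.exp (c * Real.log 2 / t - 1) * Real.exp 1 := by
        rw [← Real.exp_add]; congr 1; ring
      rw [h5] at heq
      apply mul_right_cancel₀ he.ne'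
      linarith
    rw [← hxw]
    field_simp
    simp
  · intro ht
    have hx : c * Real.log 2 / t = w + 1 := by
      rw [ht]; field_simp
    refine ⟨by rw [ht]; positivity, ?_⟩
    rw [hx, Real.exp_add]
    linarith
end

section
/- Let S be a finite nonempty set, let h_v > 0 for v ∈ S, and let c, n0 > 0. For λ > 0 and v ∈ S let t_v(λ) denote the unique t > 0 with (1 − (c·ln 2)/t)·2^{c/t} − 1 = −λ·h_v/n0. Then each function λ ↦ t_v(λ) is continuous and strictly decreasing on (0,∞), with t_v(λ) → ∞ as λ → 0⁺ and t_v(λ) → 0 as λ → ∞. Consequently, for every T > 0 there exists a unique λ⋆ > 0 with ∑_{v∈S} t_v(λ⋆) = T. -/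
open Filter Topology

lemma aux_phi : StrictMonoOn (fun x : ℝ => 1 - (1 - x) * Real.exp x) (Set.Ici 0) := by
  apply strictMonoOn_of_deriv_pos (convex_Ici 0)
  · fun_prop
  · intro x hx
    rw [interior_Ici] at hx
    have hd : HasDerivAt (fun x : ℝ => 1 - (1 - x) * Real.exp x) (x * Real.exp x) x := by
      have := (((hasDerivAt_id x).const_sub 1).mul (Real.hasDerivAt_exp x)).const_sub 1
      refine HasDerivAt.congr_deriv (f := fun x : ℝ => 1 - (1 - x) * Real.exp x) this ?_
      simp only [id]
      ring
    rw [hd.deriv]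
    exact mul_pos hx (Real.exp_pos x)

lemma aux_inv (f g : ℝ → ℝ) (hf : ∀ l, 0 < l → 0 < f l ∧ g (f l) = l)
    (hg : ∀ t, 0 < t → 0 < g t ∧ f (g t) = t) (hanti : StrictAntiOn g (Set.Ioi 0)) :
    ContinuousOn f (Set.Ioi 0) ∧ StrictAntiOn f (Set.Ioi 0) ∧
      Tendsto f (𝓝[>] 0) atTop ∧ Tendsto f atTop (𝓝 0) := by
  have fa : StrictAntiOn f (Set.Ioi 0) := by
    intro a ha b hb hab
    have h1 := hf a ha
    have h2 := hf b hb
    rw [← h1.2, ← h2.2] at hab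
    exact (hanti.lt_iff_gt h1.1 h2.1).1 hab
  -- comparison of values with the inverse
  have lo : ∀ t l, 0 < t → 0 < l → l < g t → t < f l := by
    intro t l ht hl hlt
    have h1 := hg t ht
    have := fa hl h1.1 hlt
    rwa [h1.2] at this
  have hi : ∀ t l, 0 < t → g t < l → f l < t := by
    intro t l ht hlt
    have h1 := hg t ht
    have := fa h1.1 (h1.1.trans hlt) hlt
    rwa [h1.2] at this
  refine ⟨?_, fa, ?_, ?_⟩
  · intro l hl
    have hl1 := hf l hl
    refine tendsto_order.2 ⟨fun a ha => ?_, fun b hb => ?_⟩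
    · have h0 : 0 < max a (f l / 2) := lt_max_of_lt_right (by linarith)
      have h1 : max a (f l / 2) < f l := max_lt ha (by linarith)
      have h2 : l < g (max a (f l / 2)) := by
        have := hanti h0 hl1.1 h1
        rwa [hl1.2] at this
      filter_upwards [self_mem_nhdsWithin, mem_nhdsWithin_of_mem_nhds (Iio_mem_nhds h2)]
        with x hx hx2
      exact (le_max_left _ _).trans_lt (lo _ x h0 hx hx2)
    · have h0 : 0 < b := hl1.1.trans hb
      have h2 : g b < l := by
        have := hanti hl1.1 h0 hb
        rwa [hl1.2] at this
      filter_upwards [mem_nhdsWithin_of_mem_nhds (Ioi_mem_nhds h2)] with x hx2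
      exact hi b x h0 hx2
  · refine tendsto_atTop.2 fun M => ?_
    have h0 : 0 < max M 1 := lt_max_of_lt_right one_pos
    filter_upwards [self_mem_nhdsWithin,
      mem_nhdsWithin_of_mem_nhds (Iio_mem_nhds (hg _ h0).1)] with x hx hx2
    exact (le_max_left _ _).trans (lo _ x h0 hx hx2).le
  · refine tendsto_order.2 ⟨fun a ha => ?_, fun b hb => ?_⟩
    · filter_upwards [eventually_gt_atTop 0] with x hx
      exact ha.trans (hf x hx).1
    · filter_upwards [eventually_gt_atTop (g b)] with x hx
      exact hi b x hb hx

/-- properties of the optimal per-view time allocations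
`λ ↦ t_v(λ)` and existence/uniqueness of the water level `λ⋆` with
`∑_{v∈S} t_v(λ⋆) = T`. -/
theorem stmt_6 {S : Type*} [Fintype S] [Nonempty S]
    (h : S → ℝ) (c n0 : ℝ) (hh : ∀ v, 0 < h v) (hc : 0 < c) (hn0 : 0 < n0)
    (tfun : S → ℝ → ℝ)
    -- `tfun v l` is the unique `t > 0` solving the stationarity equation
    (htfun : ∀ v, ∀ l : ℝ, 0 < l →
      (0 < tfun v l ∧
        (1 - c * Real.log 2 / tfun v l) * (2 : ℝ) ^ (c / tfun v l) - 1
          = -(l * h v / n0)) ∧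
      ∀ t : ℝ, 0 < t →
        (1 - c * Real.log 2 / t) * (2 : ℝ) ^ (c / t) - 1 = -(l * h v / n0) →
        t = tfun v l) :
    (∀ v, ContinuousOn (tfun v) (Set.Ioi 0))
    ∧ (∀ v, StrictAntiOn (tfun v) (Set.Ioi 0))
    ∧ (∀ v, Tendsto (tfun v) (𝓝[>] 0) atTop)
    ∧ (∀ v, Tendsto (tfun v) atTop (𝓝 0))
    ∧ (∀ T : ℝ, 0 < T → ∃! l : ℝ, 0 < l ∧ ∑ v, tfun v l = T) := by
  have key : ∀ v, ContinuousOn (tfun v) (Set.Ioi 0) ∧ StrictAntiOn (tfun v) (Set.Ioi 0) ∧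
      Tendsto (tfun v) (𝓝[>] 0) atTop ∧ Tendsto (tfun v) atTop (𝓝 0) := by
    intro v
    have hv := hh v
    have hk : 0 < c * Real.log 2 := mul_pos hc (Real.log_pos (by norm_num))
    have hpow : ∀ t : ℝ, (2 : ℝ) ^ (c / t) = Real.exp (c * Real.log 2 / t) := by
      intro t
      rw [Real.rpow_def_of_pos (by norm_num)]
      congr 1
      ring
    have hr : 0 < n0 / h v := div_pos hn0 hv
    have hpos : ∀ t : ℝ, 0 < t →
        0 < n0 / h v * (1 - (1 - c * Real.log 2 / t) * (2 : ℝ) ^ (c / t)) := by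
      intro t ht
      have hx : 0 < c * Real.log 2 / t := div_pos hk ht
      have := aux_phi (Set.mem_Ici.2 le_rfl) (Set.mem_Ici.2 hx.le) hx
      simp only [sub_zero, Real.exp_zero, mul_one, sub_self] at this
      rw [hpow]
      exact mul_pos hr this
    apply aux_inv (tfun v)
      (fun t => n0 / h v * (1 - (1 - c * Real.log 2 / t) * (2 : ℝ) ^ (c / t)))
    · intro l hl
      obtain ⟨⟨h1, h2⟩, -⟩ := htfun v l hl
      refine ⟨h1, ?_⟩
      have h3 : 1 - (1 - c * Real.log 2 / tfun v l) * (2 : ℝ) ^ (c / tfun v l)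
          = l * h v / n0 := by linarith
      simp only [h3]
      field_simp
    · intro t ht
      refine ⟨hpos t ht, ((htfun v _ (hpos t ht)).2 t ht ?_).symm⟩
      generalize (1 - c * Real.log 2 / t) * (2 : ℝ) ^ (c / t) = y
      field_simp
      ring
    · intro a ha b hb hab
      have ha' : 0 < a := ha
      have hb' : 0 < b := hb
      have hlt : c * Real.log 2 / b < c * Real.log 2 / a := div_lt_div_of_pos_left hk ha' hab
      have := aux_phi (Set.mem_Ici.2 (div_pos hk hb').le) (Set.mem_Ici.2 (div_pos hk ha').le) hlt
      simp only [hpow]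
      exact mul_lt_mul_of_pos_left this hr
  refine ⟨fun v => (key v).1, fun v => (key v).2.1, fun v => (key v).2.2.1,
    fun v => (key v).2.2.2, fun T hT => ?_⟩
  have Fa : StrictAntiOn (fun l => ∑ v, tfun v l) (Set.Ioi 0) := by
    intro a ha b hb hab
    exact Finset.sum_lt_sum_of_nonempty Finset.univ_nonempty
      fun v _ => (key v).2.1 ha hb hab
  have Fc : ContinuousOn (fun l => ∑ v, tfun v l) (Set.Ioi 0) :=
    continuousOn_finsetSum _ fun v _ => (key v).1
  have F0 : Tendsto (fun l => ∑ v, tfun v l) atTop (𝓝 0) := by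
    simpa using tendsto_finsetSum Finset.univ fun v _ => (key v).2.2.2
  obtain ⟨b, hb, hb0⟩ := ((F0.eventually (gt_mem_nhds hT)).and (eventually_gt_atTop 0)).exists
  obtain ⟨v0⟩ := ‹Nonempty S›
  obtain ⟨a, ha, ha0⟩ := (((key v0).2.2.1.eventually (eventually_ge_atTop T)).and
    self_mem_nhdsWithin).exists
  have ha1 : T ≤ ∑ v, tfun v a := ha.trans
    (Finset.single_le_sum (f := fun v => tfun v a)
      (fun v _ => (htfun v a ha0).1.1.le) (Finset.mem_univ v0))
  obtain ⟨l, hl, hlT⟩ := isPreconnected_Ioi.intermediate_value (Set.mem_Ioi.2 hb0) ha0 Fc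
    ⟨hb.le, ha1⟩
  exact ⟨l, ⟨hl, hlT⟩, fun m hm => Fa.injOn hm.1 hl (hm.2.trans hlT.symm)⟩
end

section
/- Let c, n0, λ be positive reals. For h > 0 let t(h) denote the unique t > 0 with (1 − (c·ln 2)/t)·2^{c/t} − 1 = −λ·h/n0. Then h ↦ t(h) is strictly decreasing on (0, ∞). -/
theorem aux_anti (u v : ℝ) (hu : 0 ≤ u) (huv : u ≤ v) :
    (1 - v) * Real.exp v ≤ (1 - u) * Real.exp u := by
  have e : Real.exp u = Real.exp (u - v) * Real.exp v := by
    rw [← Real.exp_add]; congr 1; ring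
  have key : 1 - v ≤ (1 - u) * Real.exp (u - v) := by
    rcases le_total u 1 with h | h
    · have h1 := Real.add_one_le_exp (u - v)
      nlinarith [mul_le_mul_of_nonneg_left h1 (sub_nonneg.2 h),
        mul_nonneg hu (sub_nonneg.2 huv)]
    · have h1 : Real.exp (u - v) ≤ 1 := Real.exp_le_one_iff.2 (by linarith)
      nlinarith [mul_nonneg (sub_nonneg.2 h) (sub_nonneg.2 h1)]
  rw [e, ← mul_assoc]
  exact mul_le_mul_of_nonneg_right key (Real.exp_pos v).le

/-- the optimal time allocation, as a function of the minimum
channel power `h`, is strictly decreasing on `(0, ∞)`. -/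
theorem stmt_7 (c n0 l : ℝ) (hc : 0 < c) (hn0 : 0 < n0) (hl : 0 < l)
    (tfun : ℝ → ℝ)
    -- `tfun h` is the unique `t > 0` solving the stationarity equation
    (htfun : ∀ h : ℝ, 0 < h →
      (0 < tfun h ∧
        (1 - c * Real.log 2 / tfun h) * (2 : ℝ) ^ (c / tfun h) - 1
          = -(l * h / n0)) ∧
      ∀ t : ℝ, 0 < t →
        (1 - c * Real.log 2 / t) * (2 : ℝ) ^ (c / t) - 1 = -(l * h / n0) →
        t = tfun h) :
    StrictAntiOn tfun (Set.Ioi 0) := by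
  intro a ha b hb hab
  obtain ⟨⟨ta, ea⟩, -⟩ := htfun a ha
  obtain ⟨⟨tb, eb⟩, -⟩ := htfun b hb
  by_contra hcon
  have hle : tfun a ≤ tfun b := not_lt.1 hcon
  have hlog : 0 < Real.log 2 := Real.log_pos (by norm_num)
  have hcl : 0 < c * Real.log 2 := mul_pos hc hlog
  have hpow : ∀ t : ℝ, (2 : ℝ) ^ (c / t) = Real.exp (c * Real.log 2 / t) := by
    intro t
    rw [Real.rpow_def_of_pos (by norm_num)]
    congr 1; ring
  rw [hpow] at ea eb
  have h1 := aux_anti (c * Real.log 2 / tfun b) (c * Real.log 2 / tfun a)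
    (div_pos hcl tb).le (div_le_div_of_nonneg_left hcl.le ta hle)
  have h2 : l * a / n0 < l * b / n0 :=
    div_lt_div_of_pos_right (mul_lt_mul_of_pos_left hab hl) hn0
  linarith
end

section
/- Let K be a finite nonempty set, V̄ a finite nonempty set, h_k > 0 for k ∈ K, y_{k,v} ∈ {0,1} for k ∈ K and v ∈ V̄, and B, R, T, n0 > 0. Let S = {v ∈ V̄ : y_{k,v} = 1 for some k ∈ K} and, for v ∈ S, let h_{v,min} = min{h_k : k ∈ K, y_{k,v} = 1}. Then the infimum of ∑_{v∈V̄} t_v·p_v over all (t, p) with t_v ≥ 0, p_v ≥ 0, ∑_{v∈V̄} t_v ≤ T, and t_v·B·log₂(1 + p_v·h_k/n0) ≥ y_{k,v}·R·T for all k ∈ K and v ∈ V̄, equals the infimum of ∑_{v∈S} (n0·t_v/h_{v,min})·(2^{R·T/(B·t_v)} − 1) over all t with t_v > 0 for v ∈ S and ∑_{v∈S} t_v ≤ T. -/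
open scoped Classical

lemma key_aux {B R T n0 c t p : ℝ} (hB : 0 < B) (hn0 : 0 < n0) (hc : 0 < c) (ht : 0 < t)
    (hp : 0 ≤ p) : R * T ≤ t * B * Real.logb 2 (1 + p * c / n0) ↔
      n0 / c * ((2 : ℝ) ^ (R * T / (B * t)) - 1) ≤ p := by
  have h1 : 0 < 1 + p * c / n0 := by positivity
  have h2 : R * T ≤ t * B * Real.logb 2 (1 + p * c / n0) ↔
      R * T / (B * t) ≤ Real.logb 2 (1 + p * c / n0) := by
    rw [div_le_iff₀ (by positivity)]
    constructor <;> intro h <;> linarith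
  rw [h2, Real.le_logb_iff_rpow_le (by norm_num) h1, div_mul_eq_mul_div, div_le_iff₀ hc,
    ← sub_le_iff_le_add', le_div_iff₀ hn0, mul_comm]

/-- reduction of the time-and-power allocation problem to an
equivalent problem in the times only. -/
theorem stmt_8 {K V : Type*} [Fintype K] [Nonempty K] [Fintype V] [Nonempty V]
    (h : K → ℝ) (y : K → V → ℝ) (B R T n0 : ℝ)
    (hh : ∀ k, 0 < h k) (hy : ∀ k v, y k v = 0 ∨ y k v = 1)
    (hB : 0 < B) (hR : 0 < R) (hT : 0 < T) (hn0 : 0 < n0) :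
    sInf {E : ℝ | ∃ t p : V → ℝ,
        (∀ v, 0 ≤ t v) ∧ (∀ v, 0 ≤ p v) ∧ (∑ v, t v ≤ T) ∧
        (∀ k v, t v * B * Real.logb 2 (1 + p v * h k / n0) ≥ y k v * R * T) ∧
        E = ∑ v, t v * p v}
    =
    sInf {E : ℝ | ∃ t : V → ℝ,
        (∀ v ∈ Finset.univ.filter (fun v => ∃ k, y k v = 1), 0 < t v) ∧
        (∑ v ∈ Finset.univ.filter (fun v => ∃ k, y k v = 1), t v ≤ T) ∧
        E = ∑ v ∈ Finset.univ.filter (fun v => ∃ k, y k v = 1),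
              (n0 * t v / sInf (h '' {k | y k v = 1})) *
                ((2 : ℝ) ^ (R * T / (B * t v)) - 1)} := by
  set S := Finset.univ.filter (fun v => ∃ k, y k v = 1) with hS
  have hmS : ∀ v, v ∈ S ↔ ∃ k, y k v = 1 := fun v => by simp [hS]
  set m : V → ℝ := fun v => sInf (h '' {k | y k v = 1}) with hm
  have hmle : ∀ k v, y k v = 1 → m v ≤ h k := fun k v hk =>
    csInf_le (Set.toFinite _).bddBelow ⟨k, hk, rfl⟩
  have hmem : ∀ v ∈ S, ∃ k, y k v = 1 ∧ h k = m v := by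
    intro v hv
    obtain ⟨k, hk⟩ := (hmS v).1 hv
    have : (h '' {k | y k v = 1}).Nonempty := ⟨h k, k, hk, rfl⟩
    obtain ⟨k2, hk2, e⟩ := this.csInf_mem (Set.toFinite _)
    exact ⟨k2, hk2, e⟩
  have hmpos : ∀ v ∈ S, 0 < m v := by
    intro v hv
    obtain ⟨k, _, e⟩ := hmem v hv
    exact e ▸ hh k
  have hpow : ∀ x : ℝ, 0 < x → 0 ≤ (2 : ℝ) ^ (R * T / (B * x)) - 1 := by
    intro x hx
    have := Real.one_le_rpow (x := 2) (z := R * T / (B * x)) (by norm_num) (by positivity)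
    linarith
  set A := {E : ℝ | ∃ t p : V → ℝ,
        (∀ v, 0 ≤ t v) ∧ (∀ v, 0 ≤ p v) ∧ (∑ v, t v ≤ T) ∧
        (∀ k v, t v * B * Real.logb 2 (1 + p v * h k / n0) ≥ y k v * R * T) ∧
        E = ∑ v, t v * p v} with hA
  set C := {E : ℝ | ∃ t : V → ℝ,
        (∀ v ∈ S, 0 < t v) ∧ (∑ v ∈ S, t v ≤ T) ∧
        E = ∑ v ∈ S, (n0 * t v / m v) * ((2 : ℝ) ^ (R * T / (B * t v)) - 1)} with hC
  have hAb : BddBelow A := by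
    refine ⟨0, ?_⟩
    rintro E ⟨t, p, ht, hp, -, -, rfl⟩
    exact Finset.sum_nonneg fun v _ => mul_nonneg (ht v) (hp v)
  have hCA : C ⊆ A := by
    rintro E ⟨t, ht, hsum, rfl⟩
    refine ⟨fun v => if v ∈ S then t v else 0,
      fun v => if v ∈ S then n0 / m v * ((2 : ℝ) ^ (R * T / (B * t v)) - 1) else 0,
      ?_, ?_, ?_, ?_, ?_⟩
    · intro v
      by_cases hv : v ∈ S
      · simpa [hv] using (ht v hv).le
      · simp [hv]
    · intro v
      by_cases hv : v ∈ S
      · simp only [hv, if_true]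
        exact mul_nonneg (div_pos hn0 (hmpos v hv)).le (hpow _ (ht v hv))
      · simp [hv]
    · rw [Finset.sum_ite_mem, Finset.univ_inter]
      exact hsum
    · intro k v
      by_cases hv : v ∈ S
      · simp only [hv, if_true, ge_iff_le]
        have hq : 0 ≤ n0 / m v * ((2 : ℝ) ^ (R * T / (B * t v)) - 1) :=
          mul_nonneg (div_pos hn0 (hmpos v hv)).le (hpow _ (ht v hv))
        rcases hy k v with h0 | h1
        · rw [h0, zero_mul, zero_mul]
          have hl : 0 ≤ Real.logb 2
              (1 + n0 / m v * ((2 : ℝ) ^ (R * T / (B * t v)) - 1) * h k / n0) := by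
            apply Real.logb_nonneg (by norm_num)
            have := div_nonneg (mul_nonneg hq (hh k).le) hn0.le
            linarith
          exact mul_nonneg (mul_nonneg (ht v hv).le hB.le) hl
        · rw [h1, one_mul, key_aux hB hn0 (hh k) (ht v hv) hq]
          exact mul_le_mul_of_nonneg_right
            (div_le_div_of_nonneg_left hn0.le (hmpos v hv) (hmle k v h1)) (hpow _ (ht v hv))
      · have h0 : y k v = 0 := (hy k v).resolve_right fun h1 => hv ((hmS v).2 ⟨k, h1⟩)
        simp [hv, h0]
    · rw [← Finset.sum_subset (Finset.subset_univ S)]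
      · refine Finset.sum_congr rfl fun v hv => ?_
        simp only [hv, if_true]
        ring
      · intro v _ hv
        simp [hv]
  have hCne : C.Nonempty := by
    have hc : (0 : ℝ) < Fintype.card V := by exact_mod_cast Fintype.card_pos
    refine ⟨_, fun _ => T / Fintype.card V, fun v _ => by positivity, ?_, rfl⟩
    rw [Finset.sum_const, nsmul_eq_mul, mul_div_assoc', div_le_iff₀ hc, mul_comm]
    have : (S.card : ℝ) ≤ Fintype.card V := by exact_mod_cast Finset.card_le_univ S
    exact mul_le_mul_of_nonneg_left this hT.le
  apply le_antisymm
  · exact csInf_le_csInf hAb hCne hCA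
  · refine le_csInf (hCne.mono hCA) ?_
    rintro E ⟨t, p, ht, hp, hsum, hcon, rfl⟩
    have hRT : 0 < R * T := mul_pos hR hT
    have htpos : ∀ v ∈ S, 0 < t v := by
      intro v hv
      obtain ⟨k, hk⟩ := (hmS v).1 hv
      rcases (ht v).lt_or_eq with h2 | h2
      · exact h2
      · have := hcon k v
        rw [hk, ← h2] at this
        simp only [zero_mul, one_mul, ge_iff_le] at this
        linarith
    refine csInf_le_of_le (hAb.mono hCA) ⟨t, htpos, ?_, rfl⟩ ?_
    · exact (Finset.sum_le_sum_of_subset_of_nonneg (Finset.subset_univ S)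
        fun v _ _ => ht v).trans hsum
    · refine le_trans (Finset.sum_le_sum fun v hv => ?_)
        (Finset.sum_le_sum_of_subset_of_nonneg (Finset.subset_univ S)
          fun v _ _ => mul_nonneg (ht v) (hp v))
      obtain ⟨k, hk, e⟩ := hmem v hv
      have := hcon k v
      rw [hk, one_mul, ge_iff_le, key_aux hB hn0 (hh k) (htpos v hv) (hp v), e] at this
      calc _ = t v * (n0 / m v * ((2 : ℝ) ^ (R * T / (B * t v)) - 1)) := by ring
        _ ≤ _ := mul_le_mul_of_nonneg_left this (ht v)
end

section
/- Let K be a finite nonempty set, V̄ a finite nonempty set, h_k > 0 for k ∈ K, y_{k,v} ∈ {0,1} for k ∈ K and v ∈ V̄ with y_{k,v} = 1 for at least one pair (k,v), and B, R, T, n0 > 0. Let S = {v ∈ V̄ : y_{k,v} = 1 for some k} and h_{v,min} = min{h_k : y_{k,v} = 1} for v ∈ S. Let λ⋆ > 0 be the unique positive real such that ∑_{v∈S} t_v(λ⋆) = T, where for λ > 0 and v ∈ S, t_v(λ) = R·T·ln 2/(B·(w_v(λ) + 1)) and w_v(λ) is the unique real with w_v(λ) > −1 and w_v(λ)·e^{w_v(λ)}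 = λ·h_{v,min}/(n0·e) − 1/e. Define t⋆_v = t_v(λ⋆) and p⋆_v = (n0/h_{v,min})·(2^{R·T/(B·t⋆_v)} − 1) for v ∈ S, and t⋆_v = p⋆_v = 0 for v ∉ S. Then (t⋆, p⋆) attains the infimum of ∑_{v∈V̄} t_v·p_v over all (t, p) with t_v ≥ 0, p_v ≥ 0, ∑_{v∈V̄} t_v ≤ T, and t_v·B·log₂(1 + p_v·h_k/n0) ≥ y_{k,v}·R·T for all k ∈ K, v ∈ V̄. -/
open scoped Classical

/-- Lemma 1 of the paper: the closed-form time and power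
allocation `(t⋆, p⋆)` attains the minimum total transmission energy. -/
theorem stmt_9 {K V : Type*} [Fintype K] [Nonempty K] [Fintype V] [Nonempty V]
    (h : K → ℝ) (y : K → V → ℝ) (B R T n0 : ℝ)
    (hh : ∀ k, 0 < h k) (hy : ∀ k v, y k v = 0 ∨ y k v = 1)
    (hex : ∃ k v, y k v = 1)
    (hB : 0 < B) (hR : 0 < R) (hT : 0 < T) (hn0 : 0 < n0)
    (wfun : V → ℝ → ℝ)
    -- `wfun v l` is the Lambert-W value: `w > −1` with
    -- `w·e^w = l·h_{v,min}/(n0·e) − 1/e`, for views in `S`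
    (hw : ∀ v, (∃ k, y k v = 1) → ∀ l : ℝ, 0 < l →
      -1 < wfun v l ∧
      wfun v l * Real.exp (wfun v l)
        = l * sInf (h '' {k | y k v = 1}) / (n0 * Real.exp 1) - 1 / Real.exp 1)
    (lam : ℝ) (hlam : 0 < lam)
    -- `lam` is the water level with `∑_{v∈S} t_v(lam) = T`
    (hlamT : ∑ v ∈ Finset.univ.filter (fun v => ∃ k, y k v = 1),
        R * T * Real.log 2 / (B * (wfun v lam + 1)) = T)
    (tstar pstar : V → ℝ)
    (htstar1 : ∀ v, (∃ k, y k v = 1) →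
      tstar v = R * T * Real.log 2 / (B * (wfun v lam + 1)))
    (hpstar1 : ∀ v, (∃ k, y k v = 1) →
      pstar v = (n0 / sInf (h '' {k | y k v = 1})) *
        ((2 : ℝ) ^ (R * T / (B * tstar v)) - 1))
    (htstar0 : ∀ v, ¬(∃ k, y k v = 1) → tstar v = 0)
    (hpstar0 : ∀ v, ¬(∃ k, y k v = 1) → pstar v = 0) :
    -- `(tstar, pstar)` is feasible
    ((∀ v, 0 ≤ tstar v) ∧ (∀ v, 0 ≤ pstar v) ∧ (∑ v, tstar v ≤ T) ∧
      (∀ k v, tstar v * B * Real.logb 2 (1 + pstar v * h k / n0)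
        ≥ y k v * R * T))
    ∧
    -- and minimizes the total transmission energy among feasible points
    (∀ t p : V → ℝ,
      (∀ v, 0 ≤ t v) → (∀ v, 0 ≤ p v) → (∑ v, t v ≤ T) →
      (∀ k v, t v * B * Real.logb 2 (1 + p v * h k / n0) ≥ y k v * R * T) →
      ∑ v, tstar v * pstar v ≤ ∑ v, t v * p v) := by
  have hl2 : 0 < Real.log 2 := Real.log_pos (by norm_num)
  -- properties of the minimum channel gain
  have hmin : ∀ v, (∃ k, y k v = 1) →
      (∃ k, y k v = 1 ∧ h k = sInf (h '' {k | y k v = 1})) ∧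
      ∀ k, y k v = 1 → sInf (h '' {k | y k v = 1}) ≤ h k := by
    intro v hv
    have hfin : (h '' {k | y k v = 1}).Finite := Set.toFinite _
    have hne : (h '' {k | y k v = 1}).Nonempty := by
      obtain ⟨k, hk⟩ := hv
      exact ⟨h k, k, hk, rfl⟩
    refine ⟨?_, ?_⟩
    · obtain ⟨k, hk, e⟩ := hne.csInf_mem hfin
      exact ⟨k, hk, e⟩
    · intro k hk
      exact csInf_le hfin.bddBelow ⟨k, hk, rfl⟩
  have key : ∀ v, (∃ k, y k v = 1) → ∃ m u : ℝ, 0 < m ∧ 0 < u ∧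
      (∃ k, y k v = 1 ∧ h k = m) ∧ (∀ k, y k v = 1 → m ≤ h k) ∧
      lam * m = n0 * ((u - 1) * Real.exp u + 1) ∧
      tstar v * u = R * T * Real.log 2 / B ∧ 0 < tstar v ∧
      pstar v * m = n0 * (Real.exp u - 1) := by
    intro v hv
    obtain ⟨⟨k0, hk0, hk0m⟩, hle⟩ := hmin v hv
    obtain ⟨hw1, hw2⟩ := hw v hv lam hlam
    have ht := htstar1 v hv
    have hp := hpstar1 v hv
    have hmpos : 0 < sInf (h '' {k | y k v = 1}) := hk0m ▸ hh k0
    generalize sInf (h '' {k | y k v = 1}) = m at *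
    have hu : 0 < wfun v lam + 1 := by linarith
    have htpos : 0 < tstar v := by rw [ht]; positivity
    have htu : tstar v * (wfun v lam + 1) = R * T * Real.log 2 / B := by
      rw [ht]; field_simp
    refine ⟨m, wfun v lam + 1, hmpos, hu, ⟨k0, hk0, hk0m⟩, hle, ?_, htu, htpos, ?_⟩
    · rw [Real.exp_add, add_sub_cancel_right, ← mul_assoc, hw2]
      have := Real.exp_pos 1
      field_simp
      ring
    · have he : (2 : ℝ) ^ (R * T / (B * tstar v)) = Real.exp (wfun v lam + 1) := by
        rw [Real.rpow_def_of_pos (by norm_num)]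
        congr 1
        field_simp at htu ⊢
        linarith
      rw [hp, he]
      field_simp
  have hsumstar : ∑ v, tstar v = T := by
    rw [← hlamT, Finset.sum_filter]
    refine Finset.sum_congr rfl fun v _ => ?_
    split_ifs with hv
    · exact htstar1 v hv
    · exact htstar0 v hv
  have htnn : ∀ v, 0 ≤ tstar v := by
    intro v
    by_cases hv : ∃ k, y k v = 1
    · obtain ⟨m, u, -, -, -, -, -, -, h1, -⟩ := key v hv
      exact h1.le
    · exact (htstar0 v hv).ge
  have hpnn : ∀ v, 0 ≤ pstar v := by
    intro v
    by_cases hv : ∃ k, y k v = 1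
    · obtain ⟨m, u, hm, hu, -, -, -, -, -, hp⟩ := key v hv
      have : 0 ≤ pstar v * m := by
        rw [hp]
        exact mul_nonneg hn0.le (by linarith [Real.add_one_le_exp u])
      exact nonneg_of_mul_nonneg_left this hm
    · exact (hpstar0 v hv).ge
  refine ⟨⟨htnn, hpnn, hsumstar.le, ?_⟩, ?_⟩
  · intro k v
    have hhk := hh k
    have hpv := hpnn v
    have htv := htnn v
    rcases hy k v with h0 | h1
    · rw [h0]
      have : 0 ≤ Real.logb 2 (1 + pstar v * h k / n0) := by
        apply Real.logb_nonneg (by norm_num)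
        have : 0 ≤ pstar v * h k / n0 := by positivity
        linarith
      have : 0 ≤ tstar v * B * Real.logb 2 (1 + pstar v * h k / n0) := by positivity
      linarith
    · obtain ⟨m, u, hm, hu, -, hle, -, htu, htpos, hp⟩ := key v ⟨k, h1⟩
      have h2 : Real.exp u ≤ 1 + pstar v * h k / n0 := by
        have a : pstar v * m ≤ pstar v * h k := mul_le_mul_of_nonneg_left (hle k h1) hpv
        have b : Real.exp u - 1 ≤ pstar v * h k / n0 := by
          rw [le_div_iff₀ hn0]; linarith
        linarith
      have h3 : u ≤ Real.log (1 + pstar v * h k / n0) := by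
        rw [Real.le_log_iff_exp_le (lt_of_lt_of_le (Real.exp_pos u) h2)]; exact h2
      have h4 : u / Real.log 2 ≤ Real.logb 2 (1 + pstar v * h k / n0) := by
        rw [Real.logb]; gcongr
      have h5 : tstar v * B * (u / Real.log 2) = y k v * R * T := by
        rw [h1]
        field_simp at htu ⊢
        linarith
      rw [ge_iff_le, ← h5]
      gcongr
  · intro t p ht hp hsum hc
    have hv : ∀ v, tstar v * pstar v + lam * tstar v ≤ t v * p v + lam * t v := by
      intro v
      have htv := ht v
      have hpv := hp v
      by_cases hv : ∃ k, y k v = 1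
      · obtain ⟨m, u, hm, hu, ⟨k, hk, hkm⟩, -, hl, htu, htpos, hps⟩ := key v hv
        have hck := hc k v
        rw [hk, hkm] at hck
        have htp : 0 < t v := by
          rcases htv.lt_or_eq with h1 | h1
          · exact h1
          · rw [← h1] at hck
            have : 0 < R * T := by positivity
            linarith
        set s : ℝ := R * T * Real.log 2 / B / t v with hs
        have hts : t v * s = tstar v * u := by
          rw [htu, hs]; field_simp
        have hx : 0 < 1 + p v * m / n0 := by positivity
        have h1 : s ≤ Real.log (1 + p v * m / n0) := by
          rw [Real.logb] at hck
          rw [hs, div_div, div_le_iff₀ (by positivity)]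
          have := mul_le_mul_of_nonneg_right hck hl2.le
          have e : t v * B * (Real.log (1 + p v * m / n0) / Real.log 2) * Real.log 2
            = t v * B * Real.log (1 + p v * m / n0) := by field_simp
          rw [e] at this
          linarith
        rw [Real.le_log_iff_exp_le hx] at h1
        have h2 : Real.exp u * (1 + (s - u)) ≤ Real.exp s := by
          have : Real.exp s = Real.exp u * Real.exp (s - u) := by
            rw [← Real.exp_add]; congr 1; ring
          rw [this]
          have := Real.add_one_le_exp (s - u)
          have := Real.exp_pos u
          gcongr
          linarith
        have h3 : n0 * (Real.exp u * (1 + (s - u)) - 1) ≤ p v * m := by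
          have : Real.exp u * (1 + (s - u)) - 1 ≤ p v * m / n0 := by linarith
          rw [le_div_iff₀ hn0] at this
          linarith
        have h4 := mul_le_mul_of_nonneg_left h3 htv
        refine le_of_mul_le_mul_right ?_ hm
        have e1 : (tstar v * pstar v + lam * tstar v) * m
            = n0 * Real.exp u * (tstar v * u) := by
          linear_combination tstar v * hps + tstar v * hl
        have e2 : t v * (n0 * (Real.exp u * (1 + (s - u)) - 1)) + t v * (lam * m)
            = n0 * Real.exp u * (tstar v * u) := by
          linear_combination t v * hl + n0 * Real.exp u * hts
        rw [e1, ← e2]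
        linarith
      · rw [htstar0 v hv]
        have : 0 ≤ t v * p v + lam * t v := by positivity
        linarith
    have hall := Finset.sum_le_sum (s := Finset.univ) fun v _ => hv v
    rw [Finset.sum_add_distrib, Finset.sum_add_distrib, ← Finset.mul_sum, ← Finset.mul_sum,
      hsumstar] at hall
    have := mul_le_mul_of_nonneg_left hsum hlam.le
    linarith
end

section
/- Let K and V̄ be finite nonempty sets, V ⊆ V̄, h_k > 0 for k ∈ K, B, R, T, n0, E_b > 0, E_{u,k} ≥ 0 for k ∈ K, and for each k let r_k ∈ V̄ and V̄⁺_{r_k} ⊆ V̄. Then the function F(t, y) = ∑_{v∈V̄} t_v·max_{k∈K} (n0/h_k)·(2^{y_{k,v}·R·T/(B·t_v)} − 1) + E_b·∑_{v∈V̄∖V} max_{k∈K} y_{k,v} + ∑_{k∈K} E_{u,k}·∑_{v∈V̄⁺_{r_k}} y_{k,v} is convex on the convex set {(t, y) ∈ ℝ^{V̄} × ℝ^{K×V̄} : t_v > 0 for all v ∈ V̄}. -/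
open scoped Classical

lemma persp_aux (a b t1 t2 y1 y2 R T B c : ℝ) (ha : 0 ≤ a) (hb : 0 ≤ b) 
    (hs : 0 < a * t1 + b * t2) (h1 : 0 < t1) (h2 : 0 < t2) (hB : 0 < B) (hc : 0 ≤ c) :
    (a * t1 + b * t2) * (c * ((2 : ℝ) ^ ((a * y1 + b * y2) * R * T / (B * (a * t1 + b * t2))) - 1))
      ≤ a * (t1 * (c * ((2 : ℝ) ^ (y1 * R * T / (B * t1)) - 1)))
        + b * (t2 * (c * ((2 : ℝ) ^ (y2 * R * T / (B * t2)) - 1))) := by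
  have hconv := (convexOn_rpow_left (b := 2) (by norm_num)).2
    (Set.mem_univ (y1 * R * T / (B * t1))) (Set.mem_univ (y2 * R * T / (B * t2)))
    (show 0 ≤ a * t1 / (a * t1 + b * t2) by positivity)
    (show 0 ≤ b * t2 / (a * t1 + b * t2) by positivity) (by field_simp)
  simp only [smul_eq_mul] at hconv
  have he : a * t1 / (a * t1 + b * t2) * (y1 * R * T / (B * t1))
      + b * t2 / (a * t1 + b * t2) * (y2 * R * T / (B * t2))
      = (a * y1 + b * y2) * R * T / (B * (a * t1 + b * t2)) := by
    have := hs.ne'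
    generalize hS : a * t1 + b * t2 = S at *
    field_simp
  rw [he] at hconv
  generalize (2 : ℝ) ^ ((a * y1 + b * y2) * R * T / (B * (a * t1 + b * t2))) = Z at *
  generalize (2 : ℝ) ^ (y1 * R * T / (B * t1)) = X at *
  generalize (2 : ℝ) ^ (y2 * R * T / (B * t2)) = Y at *
  have h3 : (a * t1 + b * t2) * Z ≤ a * t1 * X + b * t2 * Y := by
    calc _ ≤ (a * t1 + b * t2) * _ := mul_le_mul_of_nonneg_left hconv hs.le
      _ = _ := by field_simp
  nlinarith [mul_le_mul_of_nonneg_left h3 hc]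

/-- the objective `E₁(t,y) + E₂(y) + E₃(y)` of the continuous
relaxation is convex on `{(t, y) : t_v > 0 for all v}`. -/
theorem stmt_11 {K V : Type*} [Fintype K] [Nonempty K] [Fintype V] [Nonempty V]
    (Vo : Finset V) (h : K → ℝ) (B R T n0 Eb : ℝ) (Eu : K → ℝ)
    (r : K → V) (Vplus : K → Finset V)
    (hh : ∀ k, 0 < h k) (hB : 0 < B) (hR : 0 < R) (hT : 0 < T)
    (hn0 : 0 < n0) (hEb : 0 < Eb) (hEu : ∀ k, 0 ≤ Eu k) :
    ConvexOn ℝ {p : (V → ℝ) × (K → V → ℝ) | ∀ v, 0 < p.1 v}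
      (fun p : (V → ℝ) × (K → V → ℝ) =>
        (∑ v, p.1 v * Finset.univ.sup' Finset.univ_nonempty
            (fun k => (n0 / h k) *
              ((2 : ℝ) ^ (p.2 k v * R * T / (B * p.1 v)) - 1)))
        + Eb * ∑ v ∈ Finset.univ \ Vo,
            Finset.univ.sup' Finset.univ_nonempty (fun k => p.2 k v)
        + ∑ k, Eu k * ∑ v ∈ Vplus k, p.2 k v) := by
  refine ⟨?_, ?_⟩
  · intro p hp q hq a b ha hb hab v
    simp only [Prod.fst_add, Prod.smul_fst, Pi.add_apply, Pi.smul_apply, smul_eq_mul]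
    have := hp v
    have := hq v
    rcases ha.eq_or_lt with rfl | ha
    · have : b = 1 := by linarith
      subst this; simpa
    · positivity
  · intro p hp q hq a b ha hb hab
    have hs : ∀ v, 0 < a * p.1 v + b * q.1 v := by
      intro v
      have := hp v
      have := hq v
      rcases ha.eq_or_lt with rfl | ha
      · have : b = 1 := by linarith
        subst this; simpa
      · positivity
    simp only [Prod.fst_add, Prod.smul_fst, Prod.snd_add, Prod.smul_snd, Pi.add_apply,
      Pi.smul_apply, smul_eq_mul]
    have e1 : ∀ v, (a * p.1 v + b * q.1 v) * Finset.univ.sup' Finset.univ_nonempty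
            (fun k => (n0 / h k) * ((2 : ℝ) ^ ((a * p.2 k v + b * q.2 k v) * R * T /
              (B * (a * p.1 v + b * q.1 v))) - 1))
        ≤ a * (p.1 v * Finset.univ.sup' Finset.univ_nonempty
            (fun k => (n0 / h k) * ((2 : ℝ) ^ (p.2 k v * R * T / (B * p.1 v)) - 1)))
          + b * (q.1 v * Finset.univ.sup' Finset.univ_nonempty
            (fun k => (n0 / h k) * ((2 : ℝ) ^ (q.2 k v * R * T / (B * q.1 v)) - 1))) := by
      intro v
      have hpv : 0 < p.1 v := hp v
      have hqv : 0 < q.1 v := hq v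
      rw [mul_comm (a * p.1 v + b * q.1 v), ← le_div_iff₀ (hs v)]
      refine Finset.sup'_le _ _ fun k _ => ?_
      rw [le_div_iff₀ (hs v), mul_comm]
      refine (persp_aux a b _ _ _ _ R T B (n0 / h k) ha hb (hs v) hpv hqv hB
        (div_pos hn0 (hh k)).le).trans ?_
      gcongr
      · exact Finset.le_sup' (fun k => (n0 / h k) *
          ((2 : ℝ) ^ (p.2 k v * R * T / (B * p.1 v)) - 1)) (Finset.mem_univ k)
      · exact Finset.le_sup' (fun k => (n0 / h k) *
          ((2 : ℝ) ^ (q.2 k v * R * T / (B * q.1 v)) - 1)) (Finset.mem_univ k)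
    have e2 : ∀ v, Finset.univ.sup' Finset.univ_nonempty (fun k => a * p.2 k v + b * q.2 k v)
        ≤ a * Finset.univ.sup' Finset.univ_nonempty (fun k => p.2 k v)
          + b * Finset.univ.sup' Finset.univ_nonempty (fun k => q.2 k v) := by
      intro v
      refine Finset.sup'_le _ _ fun k _ => ?_
      gcongr
      · exact Finset.le_sup' (fun k => p.2 k v) (Finset.mem_univ k)
      · exact Finset.le_sup' (fun k => q.2 k v) (Finset.mem_univ k)
    have s1 := Finset.sum_le_sum fun v (_ : v ∈ (Finset.univ : Finset V)) => e1 v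
    have s2 := mul_le_mul_of_nonneg_left
      (Finset.sum_le_sum fun v (_ : v ∈ Finset.univ \ Vo) => e2 v) hEb.le
    have s3 : ∑ k, Eu k * ∑ v ∈ Vplus k, (a * p.2 k v + b * q.2 k v)
        = a * ∑ k, Eu k * ∑ v ∈ Vplus k, p.2 k v + b * ∑ k, Eu k * ∑ v ∈ Vplus k, q.2 k v := by
      rw [Finset.mul_sum, Finset.mul_sum, ← Finset.sum_add_distrib]
      refine Finset.sum_congr rfl fun k _ => ?_
      rw [Finset.sum_add_distrib, ← Finset.mul_sum, ← Finset.mul_sum]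
      ring
    rw [Finset.sum_add_distrib, ← Finset.mul_sum, ← Finset.mul_sum] at s1 s2
    rw [s3]
    linarith
end

section
/- In the system setup below, the infimum of Problem 1 equals the infimum of Problem 4, where Problem 4 minimizes E₁(t, y) + E₂(y) + E₃(y) over y_{k,v} ∈ {0,1} satisfying constraint (i) of Problem 1 and over t with t_v ≥ 0 for all v ∈ V̄, ∑_{v∈V̄} t_v ≤ T, and t_v > 0 for every v such that y_{k,v} = 1 for some k. Here E₁(t, y) = ∑_{v∈V̄: t_v>0} t_v·max_{k∈K} (n0/h_k)·(2^{y_{k,v}·R·T/(B·t_v)} − 1), E₂(y) = E_b·∑_{v∈V̄∖V} max_{k∈K} y_{k,v}, and E₃(y) = ∑_{k∈K} E_{u,k}·∑_{v∈V̄⁺_{r_k}} y_{k,v}. -/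
open scoped Classical

noncomputable section

/-- The full view set `V̄ = {1, 1+1/Q, 1+2/Q, …, V}`. -/
def Vbar (V Q : ℕ) : Finset ℝ :=
  (Finset.range ((V - 1) * Q + 1)).image (fun i => 1 + (i : ℝ) / Q)

/-- The original view set `V = {1, 2, …, V}`. -/
def Vorig (V : ℕ) : Finset ℝ :=
  (Finset.range V).image (fun i => (i : ℝ) + 1)

/-- Left reference view set `V̄⁻_v = {x ∈ V̄ : v − Δ ≤ x < v}`. -/
def Vminus (V Q : ℕ) (Δ v : ℝ) : Finset ℝ :=
  (Vbar V Q).filter (fun x => v - Δ ≤ x ∧ x < v)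

/-- Right reference view set `V̄⁺_v = {x ∈ V̄ : v < x ≤ v + Δ}`. -/
def Vplus (V Q : ℕ) (Δ v : ℝ) : Finset ℝ :=
  (Vbar V Q).filter (fun x => v < x ∧ x ≤ v + Δ)

/-- Feasibility for Problem 1. -/
def Feasible {K : Type*} [Fintype K] (V Q : ℕ) (Δ B R T n0 : ℝ)
    (h : K → ℝ) (r : K → ℝ)
    (x : ℝ → ℝ) (y : K → ℝ → ℝ) (t p : ℝ → ℝ) : Prop :=
  (∀ v ∈ Vbar V Q, x v = 0 ∨ x v = 1) ∧
  (∀ k, ∀ v ∈ Vbar V Q, y k v = 0 ∨ y k v = 1) ∧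
  (∀ v ∈ Vbar V Q, 0 ≤ t v) ∧
  (∀ v ∈ Vbar V Q, 0 ≤ p v) ∧
  (∀ k, y k (r k) + ∑ v ∈ Vplus V Q Δ (r k), y k v = 1) ∧
  (∀ k, y k (r k) + ∑ v ∈ Vminus V Q Δ (r k), y k v = 1) ∧
  (∀ k, ∀ v ∈ Vbar V Q, y k v ≤ x v) ∧
  (∑ v ∈ Vbar V Q, t v ≤ T) ∧
  (∀ k, ∀ v ∈ Vbar V Q,
    y k v * R * T ≤ t v * B * Real.logb 2 (1 + p v * h k / n0))

/-- The weighted sum energy `E(t, p, x, y)` of Problem 1. -/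
def Energy {K : Type*} [Fintype K] (V Q : ℕ) (Eb β : ℝ) (Eu : K → ℝ)
    (r : K → ℝ) (x : ℝ → ℝ) (y : K → ℝ → ℝ) (t p : ℝ → ℝ) : ℝ :=
  ∑ v ∈ Vbar V Q, t v * p v
    + Eb * ∑ v ∈ Vbar V Q \ Vorig V, x v
    + β * ∑ k, (1 - y k (r k)) * Eu k

/-- Feasibility for Problem 4. -/
def Feasible4 {K : Type*} [Fintype K] (V Q : ℕ) (Δ T : ℝ) (r : K → ℝ)
    (y : K → ℝ → ℝ) (t : ℝ → ℝ) : Prop :=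
  (∀ k, ∀ v ∈ Vbar V Q, y k v = 0 ∨ y k v = 1) ∧
  (∀ k, y k (r k) + ∑ v ∈ Vplus V Q Δ (r k), y k v = 1) ∧
  (∀ k, y k (r k) + ∑ v ∈ Vminus V Q Δ (r k), y k v = 1) ∧
  (∀ v ∈ Vbar V Q, 0 ≤ t v) ∧
  (∑ v ∈ Vbar V Q, t v ≤ T) ∧
  (∀ v ∈ Vbar V Q, (∃ k, y k v = 1) → 0 < t v)

/-- The objective `E₁(t, y) + E₂(y) + E₃(y)` of Problem 4 (with the weighted
user synthesis energy `β·E_{u,k}` in `E₃`). -/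
def Energy4 {K : Type*} [Fintype K] [Nonempty K] (V Q : ℕ)
    (Δ B R T n0 Eb β : ℝ) (Eu h : K → ℝ) (r : K → ℝ)
    (y : K → ℝ → ℝ) (t : ℝ → ℝ) : ℝ :=
  (∑ v ∈ (Vbar V Q).filter (fun v => 0 < t v),
      t v * Finset.univ.sup' Finset.univ_nonempty
        (fun k => (n0 / h k) * ((2 : ℝ) ^ (y k v * R * T / (B * t v)) - 1)))
    + Eb * ∑ v ∈ Vbar V Q \ Vorig V,
        Finset.univ.sup' Finset.univ_nonempty (fun k => y k v)
    + ∑ k, β * Eu k * ∑ v ∈ Vplus V Q Δ (r k), y k v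

theorem rate_iff_aux (B c n0 h t p : ℝ) (hB : 0 < B) (hn0 : 0 < n0) (hh : 0 < h)
    (ht : 0 < t) (hp : 0 ≤ p) :
    c ≤ t * B * Real.logb 2 (1 + p * h / n0) ↔
      (n0 / h) * ((2 : ℝ) ^ (c / (B * t)) - 1) ≤ p := by
  have hpos : 0 < 1 + p * h / n0 := by positivity
  have h1 : c ≤ t * B * Real.logb 2 (1 + p * h / n0) ↔
      c / (B * t) ≤ Real.logb 2 (1 + p * h / n0) := by
    rw [div_le_iff₀ (by positivity)]
    constructor <;> intro hc <;> linarith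
  rw [h1, Real.le_logb_iff_rpow_le (by norm_num) hpos]
  have h2 : (n0 / h) * ((2 : ℝ) ^ (c / (B * t)) - 1) ≤ p ↔
      (2 : ℝ) ^ (c / (B * t)) - 1 ≤ p * h / n0 := by
    rw [div_mul_eq_mul_div, div_le_iff₀ hh, le_div_iff₀ hn0, mul_comm n0]
  rw [h2]
  constructor <;> intro hc <;> linarith

theorem user_energy_aux {K : Type*} [Fintype K] (V Q : ℕ) (Δ β : ℝ) (Eu r : K → ℝ)
    (y : K → ℝ → ℝ) (hy : ∀ k, y k (r k) + ∑ v ∈ Vplus V Q Δ (r k), y k v = 1) :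
    β * ∑ k, (1 - y k (r k)) * Eu k = ∑ k, β * Eu k * ∑ v ∈ Vplus V Q Δ (r k), y k v := by
  rw [Finset.mul_sum]
  refine Finset.sum_congr rfl fun k _ => ?_
  rw [← hy k]
  ring

/-- Lemma 3: the infimum of Problem 1 equals the infimum of
Problem 4. -/
theorem stmt_14 {K : Type*} [Fintype K] [Nonempty K]
    (V Q : ℕ) (Δ B R T n0 Eb β : ℝ) (Eu h : K → ℝ) (r : K → ℝ)
    (hV : 2 ≤ V) (hQ : 2 ≤ Q) (hΔ : 1 ≤ Δ)
    (hB : 0 < B) (hR : 0 < R) (hT : 0 < T) (hn0 : 0 < n0) (hEb : 0 < Eb)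
    (hβ : 1 ≤ β) (hEu : ∀ k, 0 < Eu k) (hh : ∀ k, 0 < h k)
    (hr : ∀ k, r k ∈ Vbar V Q) :
    sInf {e : ℝ | ∃ (x : ℝ → ℝ) (y : K → ℝ → ℝ) (t p : ℝ → ℝ),
        Feasible V Q Δ B R T n0 h r x y t p ∧
        e = Energy V Q Eb β Eu r x y t p}
    = sInf {e : ℝ | ∃ (y : K → ℝ → ℝ) (t : ℝ → ℝ),
        Feasible4 V Q Δ T r y t ∧
        e = Energy4 V Q Δ B R T n0 Eb β Eu h r y t} := by
  set S1 := {e : ℝ | ∃ (x : ℝ → ℝ) (y : K → ℝ → ℝ) (t p : ℝ → ℝ),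
        Feasible V Q Δ B R T n0 h r x y t p ∧
        e = Energy V Q Eb β Eu r x y t p} with hS1
  set S4 := {e : ℝ | ∃ (y : K → ℝ → ℝ) (t : ℝ → ℝ),
        Feasible4 V Q Δ T r y t ∧
        e = Energy4 V Q Δ B R T n0 Eb β Eu h r y t} with hS4
  have hsub : S4 ⊆ S1 := by
    rintro e ⟨y, t, ⟨hy, hyp, hym, ht, htT, htpos⟩, rfl⟩
    have hsup : ∀ v, ∀ k, y k v ≤
        Finset.univ.sup' Finset.univ_nonempty (fun k => y k v) := fun v k =>
      Finset.le_sup' (fun k => y k v) (Finset.mem_univ k)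
    let P : ℝ → ℝ := fun v => Finset.univ.sup' Finset.univ_nonempty
        (fun k => (n0 / h k) * ((2 : ℝ) ^ (y k v * R * T / (B * t v)) - 1))
    have hPle : ∀ v k, (n0 / h k) * ((2 : ℝ) ^ (y k v * R * T / (B * t v)) - 1) ≤ P v :=
      fun v k => Finset.le_sup'
        (fun k => (n0 / h k) * ((2 : ℝ) ^ (y k v * R * T / (B * t v)) - 1)) (Finset.mem_univ k)
    have hP0 : ∀ v ∈ Vbar V Q, 0 < t v → 0 ≤ P v := by
      intro v hv htv
      obtain ⟨k⟩ := ‹Nonempty K›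
      refine le_trans ?_ (hPle v k)
      have hy0 : 0 ≤ y k v := by rcases hy k v hv with h0 | h0 <;> rw [h0]; exact zero_le_one
      have := hh k
      have h1 : (1 : ℝ) ≤ (2 : ℝ) ^ (y k v * R * T / (B * t v)) :=
        Real.one_le_rpow (by norm_num) (by positivity)
      exact mul_nonneg (by positivity) (by linarith)
    refine ⟨fun v => Finset.univ.sup' Finset.univ_nonempty (fun k => y k v), y, t,
      fun v => if 0 < t v then P v else 0,
      ⟨?_, hy, ht, ?_, hyp, hym, fun k v _ => hsup v k, htT, ?_⟩, ?_⟩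
    · intro v hv
      obtain ⟨k, _, hk⟩ := Finset.exists_mem_eq_sup' Finset.univ_nonempty (fun k => y k v)
      simp only [hk]
      exact hy k v hv
    · intro v hv
      dsimp only
      split_ifs with htv
      · exact hP0 v hv htv
      · exact le_rfl
    · intro k v hv
      dsimp only
      split_ifs with htv
      · exact (rate_iff_aux B _ n0 (h k) (t v) (P v) hB hn0 (hh k) htv (hP0 v hv htv)).2 (hPle v k)
      · rcases hy k v hv with h0 | h0
        · simp [h0]
        · exact absurd (htpos v hv ⟨k, h0⟩) htv
    · unfold Energy Energy4
      rw [user_energy_aux V Q Δ β Eu r y hyp, Finset.sum_filter]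
      congr 2
      refine Finset.sum_congr rfl fun v _ => ?_
      by_cases htv : 0 < t v <;> simp [P, htv]
  have hdom : ∀ e ∈ S1, ∃ e' ∈ S4, e' ≤ e := by
    rintro e ⟨x, y, t, p, ⟨hx, hy, ht, hp, hyp, hym, hyx, htT, hrate⟩, rfl⟩
    refine ⟨_, ⟨y, t, ⟨hy, hyp, hym, ht, htT, ?_⟩, rfl⟩, ?_⟩
    · rintro v hv ⟨k, hk⟩
      refine lt_of_le_of_ne (ht v hv) fun h0 => ?_
      have := hrate k v hv
      rw [hk, ← h0] at this
      have := mul_pos hR hT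
      linarith
    · unfold Energy Energy4
      rw [user_energy_aux V Q Δ β Eu r y hyp, Finset.sum_filter]
      refine add_le_add (add_le_add ?_ ?_) le_rfl
      · refine Finset.sum_le_sum fun v hv => ?_
        split_ifs with htv
        · refine mul_le_mul_of_nonneg_left ?_ htv.le
          refine Finset.sup'_le _ _ fun k _ => ?_
          exact (rate_iff_aux B _ n0 (h k) (t v) (p v) hB hn0 (hh k) htv (hp v hv)).1 (hrate k v hv)
        · exact mul_nonneg (ht v hv) (hp v hv)
      · refine mul_le_mul_of_nonneg_left (Finset.sum_le_sum fun v hv => ?_) hEb.le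
        exact Finset.sup'_le _ _ fun k _ => hyx k v (Finset.mem_sdiff.1 hv).1
  have hbdd : BddBelow S1 := by
    refine ⟨0, ?_⟩
    rintro e ⟨x, y, t, p, ⟨hx, hy, ht, hp, hyp, hym, hyx, htT, hrate⟩, rfl⟩
    unfold Energy
    refine add_nonneg (add_nonneg ?_ ?_) ?_
    · exact Finset.sum_nonneg fun v hv => mul_nonneg (ht v hv) (hp v hv)
    · refine mul_nonneg hEb.le (Finset.sum_nonneg fun v hv => ?_)
      rcases hx v (Finset.mem_sdiff.1 hv).1 with h0 | h0 <;> rw [h0]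
      exact zero_le_one
    · refine mul_nonneg (by linarith) (Finset.sum_nonneg fun k _ => ?_)
      refine mul_nonneg ?_ (hEu k).le
      rcases hy k _ (hr k) with h0 | h0 <;> rw [h0] <;> norm_num
  rcases S1.eq_empty_or_nonempty with hemp | hne
  · have : S4 = ∅ := Set.subset_empty_iff.1 (hemp ▸ hsub)
    rw [hemp, this]
  · obtain ⟨e, he⟩ := hne
    obtain ⟨e', he', _⟩ := hdom e he
    apply le_antisymm
    · exact csInf_le_csInf hbdd ⟨e', he'⟩ hsub
    · refine le_csInf ⟨e, he⟩ fun a ha => ?_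
      obtain ⟨b, hb, hba⟩ := hdom a ha
      exact (csInf_le (hbdd.mono hsub) hb).trans hba

end
end
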